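/- arXiv:1605.06389 — 3 statements merged into one kernel-verified Lean document; each statement's English description precedes it below -/
import Mathlib

section
/- (Badiale–Tarantello inequality) Let 2 ≤ N ≤ n be integers and 1 < p < N. Then for every complex-valued f ∈ C_0^∞(ℝⁿ \ {x' = 0}) one has (∫_{ℝⁿ} |f(x)|^p / |x'|^p dx)^{1/p} ≤ (p/(N−p)) · (∫_{ℝⁿ} |∇f(x)|^p dx)^{1/p}. -/
open MeasureTheory

/-- The Euclidean norm of `x' = (x_1, …, x_N)`, the first `N` coordinates of `x ∈ ℝⁿ`. -/
noncomputable def sliceNorm {n : ℕ} (N : ℕ) (h : N ≤ n) (x : EuclideanSpace ℝ (Fin n)) : ℝ :=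
  Real.sqrt (∑ i : Fin N, (x (Fin.castLE h i)) ^ 2)

/-- The linear projection `x ↦ x' = (x_1, …, x_N)`. -/
noncomputable def sliceProj {n N : ℕ} (h : N ≤ n) :
    EuclideanSpace ℝ (Fin n) →L[ℝ] EuclideanSpace ℝ (Fin N) :=
  LinearMap.toContinuousLinearMap
    { toFun := fun x => WithLp.toLp 2 fun i => x (Fin.castLE h i)
      map_add' := fun x y => by ext i; simp
      map_smul' := fun c x => by ext i; simp }

/-- The vector `(x', 0)`, as the sum of its components along the coordinate axes. -/
noncomputable def sliceEmbed {n N : ℕ} (h : N ≤ n) (x : EuclideanSpace ℝ (Fin n)) :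
    EuclideanSpace ℝ (Fin n) :=
  ∑ i : Fin N, x (Fin.castLE h i) • EuclideanSpace.single (Fin.castLE h i) (1 : ℝ)

lemma sliceProj_apply {n N : ℕ} (h : N ≤ n) (x : EuclideanSpace ℝ (Fin n)) (i : Fin N) :
    sliceProj h x i = x (Fin.castLE h i) := rfl

lemma sliceNorm_eq_norm_sliceProj {n N : ℕ} (h : N ≤ n) (x : EuclideanSpace ℝ (Fin n)) :
    sliceNorm N h x = ‖sliceProj h x‖ := by
  simp [sliceNorm, EuclideanSpace.norm_eq, sliceProj_apply]

lemma sliceProj_sliceEmbed {n N : ℕ} (h : N ≤ n) (x : EuclideanSpace ℝ (Fin n)) :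
    sliceProj h (sliceEmbed h x) = sliceProj h x := by
  ext i
  simp [sliceProj_apply, sliceEmbed]

lemma norm_sliceEmbed {n N : ℕ} (h : N ≤ n) (x : EuclideanSpace ℝ (Fin n)) :
    ‖sliceEmbed h x‖ = ‖sliceProj h x‖ := by
  have key : ‖sliceEmbed h x‖ ^ 2 = ‖sliceProj h x‖ ^ 2 := by
    rw [← real_inner_self_eq_norm_sq]
    nth_rewrite 2 [sliceEmbed]
    rw [inner_sum, EuclideanSpace.real_norm_sq_eq]
    refine Finset.sum_congr rfl fun i _ => ?_
    have := congrArg (fun y => y i) (sliceProj_sliceEmbed h x)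
    simp only [sliceProj_apply] at this
    rw [inner_smul_right, EuclideanSpace.inner_single_right, sliceProj_apply]
    simp [this, sq]
  exact (sq_eq_sq₀ (norm_nonneg _) (norm_nonneg _)).1 key

lemma sliceProj_ne_zero {n N : ℕ} (h : N ≤ n) {x : EuclideanSpace ℝ (Fin n)}
    (hx : ∃ i : Fin N, x (Fin.castLE h i) ≠ 0) : sliceProj h x ≠ 0 := by
  obtain ⟨i, hi⟩ := hx
  intro h0
  exact hi (by rw [← sliceProj_apply h, h0]; rfl)

lemma contDiff_of_forall_mem_tsupport {E F : Type*} [NormedAddCommGroup E] [NormedSpace ℝ E]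
    [NormedAddCommGroup F] [NormedSpace ℝ F] {k : WithTop ℕ∞} {u : E → F}
    (h : ∀ x ∈ tsupport u, ContDiffAt ℝ k u x) : ContDiff ℝ k u := by
  refine contDiff_iff_contDiffAt.2 fun x => ?_
  by_cases hx : x ∈ tsupport u
  · exact h x hx
  · exact (contDiffAt_const (c := (0 : F))).congr_of_eventuallyEq
      (notMem_tsupport_iff_eventuallyEq.1 hx)

lemma contDiffAt_norm_comp_rpow {E F : Type*} [NormedAddCommGroup E] [NormedSpace ℝ E]
    [NormedAddCommGroup F] [InnerProductSpace ℝ F] (L : E →L[ℝ] F) (r : ℝ) {x : E}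
    (hx : L x ≠ 0) : ContDiffAt ℝ 1 (fun y => ‖L y‖ ^ r) x :=
  (L.contDiff.contDiffAt.norm ℝ hx).rpow_const_of_ne (norm_ne_zero_iff.2 hx)

/-- Euler's identity for the homogeneous function `y ↦ ‖L y‖ ^ r`. -/
lemma fderiv_norm_comp_rpow_apply {E F : Type*} [NormedAddCommGroup E] [NormedSpace ℝ E]
    [NormedAddCommGroup F] [InnerProductSpace ℝ F] (L : E →L[ℝ] F) (r : ℝ) {x v : E}
    (hx : L x ≠ 0) (hv : L v = L x) :
    fderiv ℝ (fun y => ‖L y‖ ^ r) x v = r * ‖L x‖ ^ r := by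
  have hn : DifferentiableAt ℝ (fun z : F => ‖z‖) (L x) :=
    (contDiffAt_norm ℝ (n := 1) hx).differentiableAt one_ne_zero
  have h1 : HasFDerivAt (fun y => ‖L y‖) ((fderiv ℝ (fun z : F => ‖z‖) (L x)).comp L) x :=
    hn.hasFDerivAt.comp x L.hasFDerivAt
  have hpos : 0 < ‖L x‖ := norm_pos_iff.2 hx
  rw [(h1.rpow_const (p := r) (Or.inl hpos.ne')).fderiv]
  simp only [smul_apply, ContinuousLinearMap.comp_apply, hv, smul_eq_mul]
  rw [hn.fderiv_norm_self, mul_assoc, Real.rpow_sub_one hpos.ne', div_mul_cancel₀ _ hpos.ne']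

/-- Integration by parts against the vector field `x ↦ (x', 0)`, whose divergence is `N`. -/
lemma integral_fderiv_sliceEmbed {n N : ℕ} (h : N ≤ n) {u : EuclideanSpace ℝ (Fin n) → ℝ}
    (hu : ContDiff ℝ 1 u) (huc : HasCompactSupport u) :
    ∫ x, fderiv ℝ u x (sliceEmbed h x) = -((N : ℝ) * ∫ x, u x) := by
  have hcont (i : Fin N) : Continuous fun x : EuclideanSpace ℝ (Fin n) =>
      x (Fin.castLE h i) := by fun_prop
  have hdc (v : EuclideanSpace ℝ (Fin n)) : Continuous fun x => fderiv ℝ u x v :=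
    (hu.continuous_fderiv one_ne_zero).clm_apply continuous_const
  have hds (v : EuclideanSpace ℝ (Fin n)) : HasCompactSupport fun x => fderiv ℝ u x v :=
    (huc.fderiv (𝕜 := ℝ)).comp_left (g := fun T : EuclideanSpace ℝ (Fin n) →L[ℝ] ℝ => T v) rfl
  have hint (i : Fin N) : Integrable fun x : EuclideanSpace ℝ (Fin n) =>
      x (Fin.castLE h i) * fderiv ℝ u x (EuclideanSpace.single (Fin.castLE h i) 1) :=
    ((hcont i).mul (hdc _)).integrable_of_hasCompactSupport (hds _).mul_left
  have hcoord (i : Fin N) (x : EuclideanSpace ℝ (Fin n)) :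
      HasFDerivAt (fun y : EuclideanSpace ℝ (Fin n) => y (Fin.castLE h i))
        (EuclideanSpace.proj (𝕜 := ℝ) (Fin.castLE h i)) x :=
    (EuclideanSpace.proj (𝕜 := ℝ) (Fin.castLE h i) : EuclideanSpace ℝ (Fin n) →L[ℝ] ℝ).hasFDerivAt
  have hui : Integrable u := hu.continuous.integrable_of_hasCompactSupport huc
  have hparts (i : Fin N) : ∫ x : EuclideanSpace ℝ (Fin n),
      x (Fin.castLE h i) * fderiv ℝ u x (EuclideanSpace.single (Fin.castLE h i) 1)
        = -∫ x, u x := by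
    have hone (x : EuclideanSpace ℝ (Fin n)) :
        fderiv ℝ (fun y : EuclideanSpace ℝ (Fin n) => y (Fin.castLE h i)) x
          (EuclideanSpace.single (Fin.castLE h i) 1) = 1 := by
      rw [(hcoord i x).fderiv]; simp
    rw [integral_mul_fderiv_eq_neg_fderiv_mul_of_integrable]
    · simp [hone]
    · simpa [hone] using hui
    · exact hint i
    · exact ((hcont i).mul hu.continuous).integrable_of_hasCompactSupport huc.mul_left
    · exact fun x _ => (hcoord i x).differentiableAt
    · exact fun x _ => (hu.differentiable one_ne_zero) x
  simp only [sliceEmbed, map_sum, map_smul, smul_eq_mul]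
  rw [integral_finsetSum _ fun i _ => hint i]
  simp [hparts]

/-- From `c * I ≤ p * I ^ (1 - 1 / p) * J ^ (1 / p)` one may divide by `I ^ (1 - 1 / p)`. -/
lemma rpow_one_div_le_of_mul_le {p c I J : ℝ} (hp : 1 < p) (hc : 0 < c) (hI : 0 ≤ I)
    (hJ : 0 ≤ J) (h : c * I ≤ p * (I ^ (1 - 1 / p) * J ^ (1 / p))) :
    I ^ (1 / p) ≤ p / c * J ^ (1 / p) := by
  have hp0 : 0 < p := by linarith
  rcases hI.eq_or_lt with rfl | hI
  · rw [Real.zero_rpow (by positivity)]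
    positivity
  have hsplit : I = I ^ (1 - 1 / p) * I ^ (1 / p) := by
    rw [← Real.rpow_add hI]; simp
  have hpos : 0 < I ^ (1 - 1 / p) := Real.rpow_pos_of_pos hI _
  rw [div_mul_eq_mul_div, le_div_iff₀ hc]
  refine le_of_mul_le_mul_left ?_ hpos
  calc I ^ (1 - 1 / p) * (I ^ (1 / p) * c) = c * (I ^ (1 - 1 / p) * I ^ (1 / p)) := by ring
    _ = c * I := by rw [← hsplit]
    _ ≤ _ := h
    _ = _ := by ring

/-- Badiale–Tarantello inequality on `ℝⁿ = ℝ^N × ℝ^{n-N}`. -/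
theorem stmt3 (n N : ℕ) (hN : 2 ≤ N) (hNn : N ≤ n) (p : ℝ) (hp1 : 1 < p) (hpN : p < N)
    (f : EuclideanSpace ℝ (Fin n) → ℂ) (hf : ContDiff ℝ (⊤ : ℕ∞) f)
    (hfc : HasCompactSupport f)
    (hfs : tsupport f ⊆ {x | ∃ i : Fin N, x (Fin.castLE hNn i) ≠ 0}) :
    (∫ x, ‖f x‖ ^ p / sliceNorm N hNn x ^ p) ^ (1 / p)
      ≤ (p / ((N : ℝ) - p)) * (∫ x, ‖fderiv ℝ f x‖ ^ p) ^ (1 / p) := by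
  have hp0 : 0 < p := by linarith
  have hf1 : ContDiff ℝ 1 f := hf.of_le (by exact_mod_cast le_top)
  have hL {x} (hx : x ∈ tsupport f) : sliceProj hNn x ≠ 0 := sliceProj_ne_zero hNn (hfs hx)
  set L := sliceProj hNn
  set g : EuclideanSpace ℝ (Fin n) → ℝ := fun x => ‖f x‖ / ‖L x‖ with hg
  set u : EuclideanSpace ℝ (Fin n) → ℝ := fun x => ‖f x‖ ^ p * ‖L x‖ ^ (-p) with hu
  have hg0 (x) : 0 ≤ g x := by positivity
  have hgu (x) : g x ^ p = u x := by
    simp only [hg, hu]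
    rw [Real.div_rpow (norm_nonneg _) (norm_nonneg _), Real.rpow_neg (norm_nonneg _),
      div_eq_mul_inv]
  have hfp : ContDiff ℝ 1 fun x => ‖f x‖ ^ p := hf1.norm_rpow hp1
  have hgsub : Function.support g ⊆ Function.support f := fun x hx h0 => hx (by simp [hg, h0])
  have husub : Function.support u ⊆ Function.support f := fun x hx h0 =>
    hx (by simp [hu, h0, hp0.ne'])
  have huC : ContDiff ℝ 1 u := contDiff_of_forall_mem_tsupport fun x hx =>
    hfp.contDiffAt.mul (contDiffAt_norm_comp_rpow L _ (hL (closure_mono husub hx)))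
  have hgC : Continuous g := continuous_of_tsupport fun x hx =>
    hf1.continuous.norm.continuousAt.div L.continuous.norm.continuousAt
      (norm_ne_zero_iff.2 (hL (closure_mono hgsub hx)))
  have hgc : HasCompactSupport g := hfc.mono hgsub
  have huc : HasCompactSupport u := hfc.mono husub
  have hDC : Continuous fun x => ‖fderiv ℝ f x‖ := (hf1.continuous_fderiv one_ne_zero).norm
  have hDc : HasCompactSupport fun x => ‖fderiv ℝ f x‖ := (hfc.fderiv (𝕜 := ℝ)).norm
  have hgpC : Continuous fun x => g x ^ (p - 1) :=
    hgC.rpow_const fun x => Or.inr (by linarith)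
  have hgpc : HasCompactSupport fun x => g x ^ (p - 1) :=
    hgc.comp_left (g := fun t : ℝ => t ^ (p - 1)) (Real.zero_rpow (by linarith))
  have hpt (x) : -fderiv ℝ u x (sliceEmbed hNn x)
      ≤ p * u x + p * (g x ^ (p - 1) * ‖fderiv ℝ f x‖) := by
    by_cases hx : x ∈ tsupport f
    · have hLx := hL hx
      have hpos : 0 < ‖L x‖ := norm_pos_iff.2 hLx
      have hmul : fderiv ℝ u x = _ := fderiv_fun_mul (hfp.differentiable one_ne_zero x)
        ((contDiffAt_norm_comp_rpow L (-p) hLx).differentiableAt one_ne_zero)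
      have hfd : -fderiv ℝ (fun x => ‖f x‖ ^ p) x (sliceEmbed hNn x)
          ≤ p * ‖f x‖ ^ (p - 1) * ‖fderiv ℝ f x‖ * ‖L x‖ :=
        calc _ ≤ ‖fderiv ℝ (fun x => ‖f x‖ ^ p) x (sliceEmbed hNn x)‖ := neg_le_abs _
          _ ≤ ‖fderiv ℝ (fun x => ‖f x‖ ^ p) x‖ * ‖sliceEmbed hNn x‖ :=
            ContinuousLinearMap.le_opNorm _ _
          _ ≤ _ := by
            rw [norm_sliceEmbed]
            exact mul_le_mul_of_nonneg_right
              (norm_fderiv_norm_rpow_le (hf1.differentiable one_ne_zero) hp1) (norm_nonneg _)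
      have hgx : g x ^ (p - 1) = ‖f x‖ ^ (p - 1) * ‖L x‖ * ‖L x‖ ^ (-p) := by
        simp only [hg]
        rw [Real.div_rpow (norm_nonneg _) (norm_nonneg _), Real.rpow_sub_one hpos.ne',
          Real.rpow_neg hpos.le]
        field_simp
      rw [hmul]
      simp only [add_apply, smul_apply, smul_eq_mul]
      rw [fderiv_norm_comp_rpow_apply L (-p) hLx (sliceProj_sliceEmbed hNn x), hgx]
      have := mul_le_mul_of_nonneg_right hfd (Real.rpow_nonneg hpos.le (-p))
      simp only [hu]
      linarith
    · have hx' : x ∉ tsupport u := fun h => hx (closure_mono husub h)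
      rw [fderiv_of_notMem_tsupport ℝ hx', ← hgu]
      have := hg0 x
      simp only [zero_apply, neg_zero]
      positivity
  have hui : Integrable u := huC.continuous.integrable_of_hasCompactSupport huc
  have hgi : Integrable fun x => g x ^ (p - 1) * ‖fderiv ℝ f x‖ :=
    (hgpC.mul hDC).integrable_of_hasCompactSupport hDc.mul_left
  have hparts := integral_fderiv_sliceEmbed hNn huC huc
  have hle : ((N : ℝ) - p) * ∫ x, u x ≤ p * ∫ x, g x ^ (p - 1) * ‖fderiv ℝ f x‖ := by
    have h0 : ∫ x, -fderiv ℝ u x (sliceEmbed hNn x)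
        ≤ ∫ x, (p * u x + p * (g x ^ (p - 1) * ‖fderiv ℝ f x‖)) := by
      refine integral_mono ?_ ((hui.const_mul p).add (hgi.const_mul p)) hpt
      have hEC : Continuous fun x => sliceEmbed hNn x := by unfold sliceEmbed; fun_prop
      refine Continuous.integrable_of_hasCompactSupport
        ((huC.continuous_fderiv one_ne_zero).clm_apply hEC).neg ?_
      refine (huc.fderiv (𝕜 := ℝ)).mono fun x hx h0 => hx ?_
      simp [h0]
    rw [integral_neg, hparts, integral_add (hui.const_mul p) (hgi.const_mul p),
      integral_const_mul, integral_const_mul] at h0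
    linarith
  have hq := (Real.HolderConjugate.conjExponent hp1).symm
  have hholder := integral_mul_le_Lp_mul_Lq_of_nonneg (μ := volume) hq
    (Filter.Eventually.of_forall fun x => Real.rpow_nonneg (hg0 x) (p - 1))
    (Filter.Eventually.of_forall fun x => norm_nonneg (fderiv ℝ f x))
    (hgpC.memLp_of_hasCompactSupport hgpc) (hDC.memLp_of_hasCompactSupport hDc)
  have hexp (x) : (g x ^ (p - 1)) ^ Real.conjExponent p = u x := by
    rw [← Real.rpow_mul (hg0 x), ← hgu, Real.conjExponent,
      mul_div_cancel₀ _ (by linarith : p - 1 ≠ 0)]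
  have hinv : 1 / Real.conjExponent p = 1 - 1 / p := by
    rw [Real.conjExponent]; field_simp
  simp only [hexp, hinv] at hholder
  have hIu : ∫ x, ‖f x‖ ^ p / sliceNorm N hNn x ^ p = ∫ x, u x := by
    refine integral_congr_ae (Filter.Eventually.of_forall fun x => ?_)
    simp only [hu]
    rw [sliceNorm_eq_norm_sliceProj, Real.rpow_neg (norm_nonneg _), div_eq_mul_inv]
  rw [hIu]
  refine rpow_one_div_le_of_mul_le hp1 (by linarith)
    (integral_nonneg fun x => by simp only [hu]; positivity)
    (integral_nonneg fun x => by positivity)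
    (hle.trans (mul_le_mul_of_nonneg_left hholder hp0.le))
end

section
/- Let 1 ≤ N ≤ n be integers and 1 < p < ∞. Then for every complex-valued f ∈ C_0^∞(ℝⁿ \ {x' = 0}) one has (N/p) ∫_{ℝⁿ} |f(x)|^p dx ≤ (∫_{ℝⁿ} |x'|^{p²} |∇f(x)|^p dx)^{1/p} · (∫_{ℝⁿ} |f(x)|^p / |x'|^p dx)^{(p−1)/p}, i.e. (N/p) ‖f‖_{L^p}^p ≤ ‖ |x'|^p ∇f ‖_{L^p} · ‖ f/|x'| ‖_{L^p}^{p−1}. -/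
open MeasureTheory

theorem sliceNorm_nonneg {n : ℕ} (N : ℕ) (h : N ≤ n) (x : EuclideanSpace ℝ (Fin n)) :
    0 ≤ sliceNorm N h x :=
  Real.sqrt_nonneg _

theorem continuous_sliceNorm {n : ℕ} (N : ℕ) (h : N ≤ n) : Continuous (sliceNorm N h) := by
  unfold sliceNorm
  fun_prop

theorem sliceNorm_pos {n : ℕ} (N : ℕ) (h : N ≤ n) {x : EuclideanSpace ℝ (Fin n)}
    (hx : ∃ i : Fin N, x (Fin.castLE h i) ≠ 0) : 0 < sliceNorm N h x := by
  obtain ⟨i, hi⟩ := hx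
  refine Real.sqrt_pos.2 (Finset.sum_pos' (fun _ _ ↦ sq_nonneg _) ⟨i, Finset.mem_univ _, ?_⟩)
  positivity

theorem norm_sum_smul_single {n : ℕ} (N : ℕ) (h : N ≤ n) (x : EuclideanSpace ℝ (Fin n)) :
    ‖∑ i : Fin N, x (Fin.castLE h i) • EuclideanSpace.single (Fin.castLE h i) (1 : ℝ)‖
      = sliceNorm N h x := by
  have ho : Orthonormal ℝ
      (fun i : Fin N ↦ EuclideanSpace.single (Fin.castLE h i) (1 : ℝ)) :=
    (EuclideanSpace.orthonormal_single (𝕜 := ℝ) (ι := Fin n)).comp _ (Fin.castLE_injective h)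
  rw [norm_eq_sqrt_real_inner, ho.inner_sum, sliceNorm]
  simp [sq]

/-- The divergence theorem for the vector field `φ x'`. -/
theorem nat_mul_integral_eq_neg_integral_sum {n : ℕ} (N : ℕ) (h : N ≤ n)
    {φ : EuclideanSpace ℝ (Fin n) → ℝ} (hφ : ContDiff ℝ 1 φ) (hc : HasCompactSupport φ) :
    N * ∫ x, φ x = -∫ x, fderiv ℝ φ x
      (∑ i : Fin N, x (Fin.castLE h i) • EuclideanSpace.single (Fin.castLE h i) (1 : ℝ)) := by
  have hD : Continuous (fderiv ℝ φ) := hφ.continuous_fderiv one_ne_zero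
  have hint (j : Fin n) : Integrable
      (fun x ↦ x j * fderiv ℝ φ x (EuclideanSpace.single j (1 : ℝ))) :=
    Continuous.integrable_of_hasCompactSupport (by fun_prop)
      ((hc.fderiv_apply ℝ _).mul_left)
  have hcoord (j : Fin n) (x : EuclideanSpace ℝ (Fin n)) :
      fderiv ℝ (fun y : EuclideanSpace ℝ (Fin n) ↦ y j) x (EuclideanSpace.single j (1 : ℝ))
        = 1 := by
    have :=
      (EuclideanSpace.proj j : EuclideanSpace ℝ (Fin n) →L[ℝ] ℝ).hasFDerivAt (x := x)
    rw [show (fun y : EuclideanSpace ℝ (Fin n) ↦ y j)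
      = (EuclideanSpace.proj j : EuclideanSpace ℝ (Fin n) →L[ℝ] ℝ) from rfl, this.fderiv]
    simp
  have hparts (j : Fin n) :
      ∫ x, x j * fderiv ℝ φ x (EuclideanSpace.single j (1 : ℝ)) = -∫ x, φ x := by
    rw [integral_mul_fderiv_eq_neg_fderiv_mul_of_integrable
      (f := fun x : EuclideanSpace ℝ (Fin n) ↦ x j)]
    · simp [hcoord]
    · simpa [hcoord] using hφ.continuous.integrable_of_hasCompactSupport hc
    · exact hint j
    · exact Continuous.integrable_of_hasCompactSupport
        (by have := hφ.continuous; fun_prop) hc.mul_left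
    · intro x _
      fun_prop
    · intro x _
      exact (hφ.differentiable one_ne_zero) x
  simp only [map_sum, map_smul, smul_eq_mul]
  rw [integral_finsetSum _ fun i _ ↦ hint (Fin.castLE h i)]
  simp [hparts]

/-- A Heisenberg–Pauli–Weyl type inequality:
`(N/p) ‖f‖_{L^p}^p ≤ ‖ |x'|^p ∇f ‖_{L^p} · ‖ f/|x'| ‖_{L^p}^{p-1}`. -/
theorem stmt8 (n N : ℕ) (hN : 1 ≤ N) (hNn : N ≤ n) (p : ℝ) (hp1 : 1 < p)
    (f : EuclideanSpace ℝ (Fin n) → ℂ) (hf : ContDiff ℝ (⊤ : ℕ∞) f)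
    (hfc : HasCompactSupport f)
    (hfs : tsupport f ⊆ {x | ∃ i : Fin N, x (Fin.castLE hNn i) ≠ 0}) :
    ((N : ℝ) / p) * ∫ x, ‖f x‖ ^ p
      ≤ (∫ x, sliceNorm N hNn x ^ (p * p) * ‖fderiv ℝ f x‖ ^ p) ^ (1 / p) *
        (∫ x, ‖f x‖ ^ p / sliceNorm N hNn x ^ p) ^ ((p - 1) / p) := by
  have hp0 : 0 < p := by linarith
  have hq0 : 0 < p - 1 := by linarith
  have hf1 : ContDiff ℝ 1 f := hf.of_le (by exact_mod_cast le_top)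
  have hfd : Differentiable ℝ f := hf1.differentiable one_ne_zero
  have hDc : Continuous (fderiv ℝ f) := hf1.continuous_fderiv one_ne_zero
  have hs := continuous_sliceNorm N hNn
  have hs0 := sliceNorm_nonneg N hNn
  set s := sliceNorm N hNn
  have hpq : p.HolderConjugate (p / (p - 1)) := Real.HolderConjugate.conjExponent hp1
  have hφ : ContDiff ℝ 1 (fun x ↦ ‖f x‖ ^ p) := hf1.norm_rpow hp1
  have hφc : HasCompactSupport (fun x ↦ ‖f x‖ ^ p) :=
    hfc.comp_left (g := fun z : ℂ ↦ ‖z‖ ^ p) (by simp [hp0.ne'])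
  have hFcont : Continuous (fun x ↦ s x ^ p * ‖fderiv ℝ f x‖) :=
    (hs.rpow_const fun _ ↦ Or.inr hp0.le).mul hDc.norm
  have hFc : HasCompactSupport (fun x ↦ s x ^ p * ‖fderiv ℝ f x‖) :=
    (hfc.fderiv ℝ).norm.mul_left
  have hquot : Continuous (fun x ↦ ‖f x‖ / s x) := by
    refine continuous_of_tsupport fun x hx ↦ ?_
    have hx' : x ∈ tsupport f := by
      refine closure_mono ?_ hx
      intro y hy hy'
      simp [hy'] at hy
    exact hf1.continuous.norm.continuousAt.div hs.continuousAt
      (sliceNorm_pos N hNn (hfs hx')).ne'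
  have hGcont : Continuous (fun x ↦ (‖f x‖ / s x) ^ (p - 1)) :=
    hquot.rpow_const fun _ ↦ Or.inr hq0.le
  have hGc : HasCompactSupport (fun x ↦ (‖f x‖ / s x) ^ (p - 1)) := by
    refine hfc.mono ?_
    intro y hy hy'
    simp [hy', hq0.ne'] at hy
  have hFG : ∀ x, s x ^ p * ‖fderiv ℝ f x‖ * (‖f x‖ / s x) ^ (p - 1)
      = ‖f x‖ ^ (p - 1) * ‖fderiv ℝ f x‖ * s x := by
    intro x
    by_cases hx : f x = 0
    · simp [hx, hq0.ne']
    · have hpos : 0 < s x := sliceNorm_pos N hNn (hfs (subset_tsupport f hx))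
      rw [Real.div_rpow (norm_nonneg _) hpos.le, Real.rpow_sub_one hpos.ne']
      have := Real.rpow_pos_of_pos hpos p
      field_simp
  have hholder := integral_mul_le_Lp_mul_Lq_of_nonneg (μ := volume) hpq
    (f := fun x ↦ s x ^ p * ‖fderiv ℝ f x‖) (g := fun x ↦ (‖f x‖ / s x) ^ (p - 1))
    (.of_forall fun x ↦ mul_nonneg (Real.rpow_nonneg (hs0 x) _) (norm_nonneg _))
    (.of_forall fun x ↦ Real.rpow_nonneg (div_nonneg (norm_nonneg _) (hs0 x)) _)
    (hFcont.memLp_of_hasCompactSupport hFc) (hGcont.memLp_of_hasCompactSupport hGc)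
  have hF (x) : (s x ^ p * ‖fderiv ℝ f x‖) ^ p = s x ^ (p * p) * ‖fderiv ℝ f x‖ ^ p := by
    rw [Real.mul_rpow (Real.rpow_nonneg (hs0 x) _) (norm_nonneg _), Real.rpow_mul (hs0 x)]
  have hG (x) : ((‖f x‖ / s x) ^ (p - 1)) ^ (p / (p - 1)) = ‖f x‖ ^ p / s x ^ p := by
    rw [← Real.rpow_mul (div_nonneg (norm_nonneg _) (hs0 x)), mul_div_cancel₀ _ hq0.ne',
      Real.div_rpow (norm_nonneg _) (hs0 x)]
  simp only [hF, hG, one_div_div] at hholder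
  refine le_trans ?_ hholder
  rw [div_mul_eq_mul_div, div_le_iff₀' hp0,
    nat_mul_integral_eq_neg_integral_sum N hNn hφ hφc, ← integral_const_mul]
  refine (neg_le_abs _).trans ((Real.norm_eq_abs _).symm.trans_le <|
    norm_integral_le_of_norm_le ?_ (.of_forall fun x ↦ ?_))
  · exact ((hFcont.mul hGcont).integrable_of_hasCompactSupport hFc.mul_right).const_mul p
  · refine (ContinuousLinearMap.le_opNorm _ _).trans ?_
    rw [norm_sum_smul_single, hFG, ← mul_assoc, ← mul_assoc]
    exact mul_le_mul_of_nonneg_right (norm_fderiv_norm_rpow_le hfd hp1) (hs0 x)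
end

section
/- (Critical Hardy inequality) Let n ≥ 2, let Ω ⊂ ℝⁿ be a bounded open set with 0 ∈ Ω, and set R = sup_{x∈Ω} ‖x‖. Then for every complex-valued f ∈ C_0^∞(Ω \ {0}) whose support is contained in {x : ‖x‖ < R}, one has (∫_Ω |f(x)|^n / (‖x‖ log(R/‖x‖))^n dx)^{1/n} ≤ (n/(n−1)) · (∫_Ω |⟨x/‖x‖, ∇f(x)⟩|^n dx)^{1/n}. -/
open MeasureTheory

/-- Integrating the divergence of `x ↦ G x • x` over the whole space gives zero. -/
lemma integral_fderiv_apply_self {n : ℕ} {G : EuclideanSpace ℝ (Fin n) → ℝ}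
    (hG : ContDiff ℝ 1 G) (hc : HasCompactSupport G) :
    Integrable (fun x => fderiv ℝ G x x) ∧
      ∫ x, fderiv ℝ G x x = -(n : ℝ) * ∫ x, G x := by
  have hcont : Continuous (fderiv ℝ G) := hG.continuous_fderiv one_ne_zero
  have hint (i : Fin n) :
      Integrable (fun x => x i * fderiv ℝ G x (EuclideanSpace.single i 1)) := by
    refine Continuous.integrable_of_hasCompactSupport (by fun_prop) ?_
    exact (hc.fderiv_apply (𝕜 := ℝ) _).mul_left
  have hGint : Integrable G := hG.continuous.integrable_of_hasCompactSupport hc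
  have hproj (i : Fin n) (x : EuclideanSpace ℝ (Fin n)) :
      HasFDerivAt (fun y : EuclideanSpace ℝ (Fin n) => y i)
        (EuclideanSpace.proj i : EuclideanSpace ℝ (Fin n) →L[ℝ] ℝ) x :=
    (EuclideanSpace.proj i : EuclideanSpace ℝ (Fin n) →L[ℝ] ℝ).hasFDerivAt
  have hone (i : Fin n) (x : EuclideanSpace ℝ (Fin n)) :
      fderiv ℝ (fun y : EuclideanSpace ℝ (Fin n) => y i) x (EuclideanSpace.single i 1) = 1 := by
    rw [(hproj i x).fderiv]
    simp
  have hparts (i : Fin n) :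
      ∫ x, x i * fderiv ℝ G x (EuclideanSpace.single i 1) = -∫ x, G x := by
    rw [integral_mul_fderiv_eq_neg_fderiv_mul_of_integrable (f := fun x => x i) (g := G) _ (hint i)]
    · simp_rw [hone, one_mul]
    · exact (Continuous.mul (by fun_prop) hG.continuous).integrable_of_hasCompactSupport
        hc.mul_left
    · exact fun x _ => (hproj i x).differentiableAt
    · exact fun x _ => hG.differentiable one_ne_zero x
    · simpa only [hone, one_mul] using hGint
  have hsum (x : EuclideanSpace ℝ (Fin n)) :
      fderiv ℝ G x x = ∑ i, x i * fderiv ℝ G x (EuclideanSpace.single i 1) := by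
    have h := congrArg (fderiv ℝ G x) ((EuclideanSpace.basisFun (Fin n) ℝ).sum_repr x)
    simpa using h.symm
  simp_rw [hsum]
  refine ⟨integrable_finsetSum _ fun i _ => hint i, ?_⟩
  rw [integral_finsetSum _ fun i _ => hint i]
  simp [hparts]

/-- Hölder's inequality turns `∫ uᵐ⁺¹ ≤ C ∫ uᵐ v` into a bound between `Lᵐ⁺¹` norms. -/
lemma integral_pow_rpow_le_of_integral_pow_mul_le {α : Type*} [TopologicalSpace α]
    [MeasurableSpace α] [OpensMeasurableSpace α] {μ : Measure α} [IsFiniteMeasureOnCompacts μ]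
    {u v : α → ℝ} (hu : Continuous u) (hv : Continuous v) (huc : HasCompactSupport u)
    (hvc : HasCompactSupport v) (hu0 : ∀ x, 0 ≤ u x) (hv0 : ∀ x, 0 ≤ v x) {m : ℕ} (hm : 1 ≤ m)
    {C : ℝ} (hC : 0 ≤ C) (h : ∫ x, u x ^ (m + 1) ∂μ ≤ C * ∫ x, u x ^ m * v x ∂μ) :
    (∫ x, u x ^ (m + 1) ∂μ) ^ (1 / ((m : ℝ) + 1))
      ≤ C * (∫ x, v x ^ (m + 1) ∂μ) ^ (1 / ((m : ℝ) + 1)) := by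
  have hm0 : (0 : ℝ) < m := by exact_mod_cast hm
  set A := ∫ x, u x ^ (m + 1) ∂μ with hA
  set B := ∫ x, v x ^ (m + 1) ∂μ with hB
  have hA0 : 0 ≤ A := integral_nonneg fun x => pow_nonneg (hu0 x) _
  have hB0 : 0 ≤ B := integral_nonneg fun x => pow_nonneg (hv0 x) _
  have hpq : (((m : ℝ) + 1) / m).HolderConjugate ((m : ℝ) + 1) := by
    rw [Real.holderConjugate_iff]
    constructor
    · rw [lt_div_iff₀ hm0]; linarith
    · field_simp
  have hucm : HasCompactSupport fun x => u x ^ m :=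
    huc.comp_left (g := fun t : ℝ => t ^ m) (zero_pow (by omega))
  have hHolder := integral_mul_le_Lp_mul_Lq_of_nonneg (μ := μ) hpq
    (f := fun x => u x ^ m) (g := v)
    (Filter.Eventually.of_forall fun x => pow_nonneg (hu0 x) _) (Filter.Eventually.of_forall hv0)
    ((hu.pow m).memLp_of_hasCompactSupport hucm) (hv.memLp_of_hasCompactSupport hvc)
  have e1 (x : α) : (u x ^ m) ^ (((m : ℝ) + 1) / m) = u x ^ (m + 1) := by
    rw [← Real.rpow_natCast, ← Real.rpow_mul (hu0 x), ← Real.rpow_natCast]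
    congr 1
    push_cast
    field_simp
  have e2 (x : α) : v x ^ ((m : ℝ) + 1) = v x ^ (m + 1) := by
    rw [← Real.rpow_natCast]
    push_cast
    rfl
  simp_rw [e1, e2] at hHolder
  rw [← hA, ← hB] at hHolder
  rcases hA0.eq_or_lt with h0 | hpos
  · rw [← h0, Real.zero_rpow (by positivity)]
    positivity
  have key : A ≤ C * (A ^ (1 / (((m : ℝ) + 1) / m)) * B ^ (1 / ((m : ℝ) + 1))) :=
    h.trans (mul_le_mul_of_nonneg_left hHolder hC)
  have hsplit : A = A ^ (1 / (((m : ℝ) + 1) / m)) * A ^ (1 / ((m : ℝ) + 1)) := by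
    rw [← Real.rpow_add hpos]
    conv_lhs => rw [← Real.rpow_one A]
    congr 1
    field_simp
  have hApos : 0 < A ^ (1 / (((m : ℝ) + 1) / m)) := by positivity
  refine le_of_mul_le_mul_left ?_ hApos
  rw [← hsplit]
  linarith

/-- The radial derivative of the weight `r⁻⁽ᵐ⁺¹⁾ log(R/r)⁻ᵐ`. -/
lemma hasDerivAt_log_weight {R r : ℝ} (hr : 0 < r) (hrR : r < R) (m : ℕ) :
    HasDerivAt (fun s : ℝ => (s ^ (m + 1) * Real.log (R / s) ^ m)⁻¹)
      ((-((m : ℝ) + 1) * (r ^ (m + 1) * Real.log (R / r) ^ m)⁻¹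
        + m * (r ^ (m + 1) * Real.log (R / r) ^ (m + 1))⁻¹) / r) r := by
  have hR : 0 < R := hr.trans hrR
  have hL : 0 < Real.log (R / r) := Real.log_pos ((one_lt_div hr).2 hrR)
  have hlog : HasDerivAt (fun s : ℝ => Real.log (R / s)) (-r⁻¹) r := by
    have := ((hasDerivAt_inv hr.ne').const_mul R).log (by positivity)
    simp only [← div_eq_mul_inv] at this
    convert this using 1
    field_simp
  have := ((hasDerivAt_pow (m + 1) r).fun_mul (hlog.fun_pow m)).fun_inv (by positivity)
  convert! this using 1
  rcases m with _ | k
  · simp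
    field_simp
  · simp only [Nat.add_sub_cancel]
    push_cast
    field_simp
    ring

/-- Differentiating a radial function along the position vector. -/
lemma fderiv_comp_norm_apply_self {E : Type*} [NormedAddCommGroup E] [InnerProductSpace ℝ E]
    {φ : ℝ → ℝ} {φ' : ℝ} {x : E} (hx : x ≠ 0) (hφ : HasDerivAt φ φ' ‖x‖) :
    fderiv ℝ (fun y : E => φ ‖y‖) x x = φ' * ‖x‖ := by
  have hN : DifferentiableAt ℝ (fun y : E => ‖y‖) x := differentiableAt_id.norm ℝ hx
  have := (hφ.comp_hasFDerivAt x hN.hasFDerivAt).fderiv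
  rw [Function.comp_def] at this
  rw [this]
  simp [hN.fderiv_norm_self]

/-- A lower bound for the directional derivative of `‖f‖ᵐ⁺¹`. -/
lemma neg_le_fderiv_norm_pow_apply {E F : Type*} [NormedAddCommGroup E] [NormedSpace ℝ E]
    [NormedAddCommGroup F] [InnerProductSpace ℝ F] {f : E → F} (hf : Differentiable ℝ f)
    {m : ℕ} (hm : 1 ≤ m) (x y : E) :
    -(((m : ℝ) + 1) * ‖f x‖ ^ m * ‖fderiv ℝ f x y‖)
      ≤ fderiv ℝ (fun z => ‖f z‖ ^ (m + 1)) x y := by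
  have hp : (1 : ℝ) < (m : ℝ) + 1 := by
    have : (1 : ℝ) ≤ m := by exact_mod_cast hm
    linarith
  have e : (fun z => ‖f z‖ ^ (m + 1)) = fun z => ‖f z‖ ^ ((m : ℝ) + 1) := by
    ext z
    rw [← Real.rpow_natCast]
    push_cast
    rfl
  rw [e, hf.fderiv_norm_rpow hp]
  refine (abs_le.1 ?_).1
  simp only [smul_apply, ContinuousLinearMap.comp_apply, innerSL_apply_apply,
    smul_eq_mul, abs_mul]
  have h1 : |(m : ℝ) + 1| = (m : ℝ) + 1 := abs_of_pos (by positivity)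
  have h2 : ‖f x‖ ^ ((m : ℝ) + 1 - 2) * ‖f x‖ = ‖f x‖ ^ m := by
    rw [← Real.rpow_add_one' (norm_nonneg _), ← Real.rpow_natCast]
    · congr 1; ring
    · have : (0 : ℝ) < m := by linarith
      intro h
      linarith
  rw [h1, abs_of_nonneg (Real.rpow_nonneg (norm_nonneg _) _), ← h2]
  have := abs_real_inner_le_norm (f x) (fderiv ℝ f x y)
  calc _ ≤ ((m : ℝ) + 1) * ‖f x‖ ^ ((m : ℝ) + 1 - 2) * (‖f x‖ * ‖fderiv ℝ f x y‖) := by gcongr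
    _ = _ := by ring

/-- The critical Hardy inequality over the whole space, for functions supported in a punctured
ball. -/
lemma critical_hardy_whole_space {m : ℕ} (hm : 1 ≤ m) {R : ℝ}
    {f : EuclideanSpace ℝ (Fin (m + 1)) → ℂ} (hf : ContDiff ℝ 1 f) (hfc : HasCompactSupport f)
    (hfs : ∀ x ∈ tsupport f, x ≠ 0 ∧ ‖x‖ < R) :
    (∫ x, (‖f x‖ / (‖x‖ * Real.log (R / ‖x‖))) ^ (m + 1)) ^ (1 / ((m : ℝ) + 1))
      ≤ (((m : ℝ) + 1) / m) *
        (∫ x, ‖fderiv ℝ f x ((‖x‖)⁻¹ • x)‖ ^ (m + 1)) ^ (1 / ((m : ℝ) + 1)) := by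
  have hm0 : (0 : ℝ) < m := by exact_mod_cast hm
  have hpos {x} (hx : x ∈ tsupport f) : 0 < ‖x‖ ∧ 0 < Real.log (R / ‖x‖) := by
    have h0 := norm_pos_iff.2 (hfs x hx).1
    exact ⟨h0, Real.log_pos ((one_lt_div h0).2 (hfs x hx).2)⟩
  have hfd : Differentiable ℝ f := hf.differentiable one_ne_zero
  have hfcont : Continuous f := hf.continuous
  have hf'cont : Continuous (fderiv ℝ f) := hf.continuous_fderiv one_ne_zero
  set u : EuclideanSpace ℝ (Fin (m + 1)) → ℝ :=
    fun x => ‖f x‖ / (‖x‖ * Real.log (R / ‖x‖)) with hu_def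
  set v : EuclideanSpace ℝ (Fin (m + 1)) → ℝ :=
    fun x => ‖fderiv ℝ f x ((‖x‖)⁻¹ • x)‖ with hv_def
  set φ : ℝ → ℝ := fun s => (s ^ (m + 1) * Real.log (R / s) ^ m)⁻¹ with hφ_def
  set G : EuclideanSpace ℝ (Fin (m + 1)) → ℝ := fun x => ‖f x‖ ^ (m + 1) * φ ‖x‖ with hG_def
  have husub : Function.support u ⊆ Function.support f := fun x hx hfx => hx (by simp [u, hfx])
  have hvsub : Function.support v ⊆ tsupport f := fun x hx => by
    refine support_fderiv_subset ℝ (f := f) fun h => hx ?_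
    simp [v, h]
  have hGsub : Function.support G ⊆ Function.support f := fun x hx hfx => hx (by simp [G, hfx])
  have hf0 {x} (hx : x ∉ tsupport f) : f x = 0 := image_eq_zero_of_notMem_tsupport hx
  have huc : HasCompactSupport u := hfc.mono husub
  have hvc : HasCompactSupport v := hfc.mono' hvsub
  have hGc : HasCompactSupport G := hfc.mono hGsub
  have hφ {x} (hx : x ∈ tsupport f) := hasDerivAt_log_weight (hpos hx).1 (hfs x hx).2 m
  have hu : Continuous u := continuous_of_tsupport fun x hx => by
    replace hx := closure_mono husub hx
    obtain ⟨h1, h2⟩ := hpos hx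
    have hR : 0 < R := h1.trans (hfs x hx).2
    refine ContinuousAt.div (by fun_prop) (ContinuousAt.mul (by fun_prop) ?_) (by positivity)
    exact ContinuousAt.log (ContinuousAt.div (by fun_prop) (by fun_prop) h1.ne') (by positivity)
  have hv : Continuous v := continuous_of_tsupport fun x hx => by
    replace hx := closure_minimal hvsub (isClosed_tsupport f) hx
    have h1 := (hpos hx).1.ne'
    refine ContinuousAt.norm (ContinuousAt.clm_apply hf'cont.continuousAt ?_)
    exact ContinuousAt.smul (ContinuousAt.inv₀ (by fun_prop) h1) continuousAt_id
  have hu0 (x) : 0 ≤ u x := by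
    by_cases hx : x ∈ tsupport f
    · obtain ⟨h1, h2⟩ := hpos hx
      positivity
    · simp [u, hf0 hx]
  have hpowC : ContDiff ℝ 1 fun x => ‖f x‖ ^ (m + 1) := by
    have := hf.norm_rpow (p := (m : ℝ) + 1) (by linarith)
    convert this using 2 with x
    rw [← Real.rpow_natCast]
    push_cast
    rfl
  have hG : ContDiff ℝ 1 G := contDiff_iff_contDiffAt.2 fun x => by
    by_cases hx : x ∈ tsupport f
    swap
    · refine (contDiffAt_const (c := (0 : ℝ))).congr_of_eventuallyEq ?_
      exact notMem_tsupport_iff_eventuallyEq.1 fun h => hx (closure_mono hGsub h)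
    obtain ⟨h1, h2⟩ := hpos hx
    have hR : 0 < R := h1.trans (hfs x hx).2
    have hN : ContDiffAt ℝ 1 (fun y : EuclideanSpace ℝ (Fin (m + 1)) => ‖y‖) x :=
      contDiffAt_norm ℝ (hfs x hx).1
    refine hpowC.contDiffAt.mul (ContDiffAt.inv ((hN.pow _).mul (ContDiffAt.pow ?_ _))
      (by positivity))
    exact ContDiffAt.log (contDiffAt_const.div hN h1.ne') (by positivity)
  have hpt (x) : m * u x ^ (m + 1)
      ≤ ((m : ℝ) + 1) * (u x ^ m * v x) + (((m : ℝ) + 1) * G x + fderiv ℝ G x x) := by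
    by_cases hx : x ∈ tsupport f
    · obtain ⟨h1, h2⟩ := hpos hx
      have hφx : DifferentiableAt ℝ
          (fun y : EuclideanSpace ℝ (Fin (m + 1)) => φ ‖y‖) x :=
        ((hφ hx).comp_hasFDerivAt x
          ((differentiableAt_id.norm ℝ (hfs x hx).1).hasFDerivAt)).differentiableAt
      have hGx : fderiv ℝ G x x = ‖f x‖ ^ (m + 1) * fderiv ℝ (fun y => φ ‖y‖) x x
          + φ ‖x‖ * fderiv ℝ (fun y => ‖f y‖ ^ (m + 1)) x x := by
        rw [hG_def, fderiv_fun_mul (hpowC.differentiable one_ne_zero x) hφx]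
        simp
      have hD := neg_le_fderiv_norm_pow_apply hfd hm x x
      have hφ0 : 0 ≤ φ ‖x‖ := by simp only [φ]; positivity
      have hD' := mul_le_mul_of_nonneg_left hD hφ0
      have hvx : ‖fderiv ℝ f x x‖ = ‖x‖ * v x := by
        simp only [v, map_smul, norm_smul, norm_inv, norm_norm]
        field_simp
      rw [hGx, fderiv_comp_norm_apply_self (hfs x hx).1 (hφ hx)]
      rw [hvx] at hD'
      have e1 : φ ‖x‖ * -(((m : ℝ) + 1) * ‖f x‖ ^ m * (‖x‖ * v x))
          = -(((m : ℝ) + 1) * (u x ^ m * v x)) := by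
        simp only [φ, u, div_pow, mul_pow]
        field_simp
        ring
      have e2 : m * u x ^ (m + 1) = ((m : ℝ) + 1) * G x + ‖f x‖ ^ (m + 1) *
          ((-((m : ℝ) + 1) * (‖x‖ ^ (m + 1) * Real.log (R / ‖x‖) ^ m)⁻¹
            + m * (‖x‖ ^ (m + 1) * Real.log (R / ‖x‖) ^ (m + 1))⁻¹) / ‖x‖ * ‖x‖) := by
        simp only [G, φ, u, div_pow, mul_pow]
        field_simp
        ring
      linarith
    · have hGx : fderiv ℝ G x = 0 := by
        by_contra h
        exact hx (closure_mono hGsub (support_fderiv_subset ℝ h))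
      have : u x = 0 := by simp [u, hf0 hx]
      have hm' : m ≠ 0 := by omega
      simp [this, hGx, G, hf0 hx, hm']
  obtain ⟨hDint, hDeq⟩ := integral_fderiv_apply_self hG hGc
  have hGint : Integrable G := hG.continuous.integrable_of_hasCompactSupport hGc
  have huint : Integrable fun x => u x ^ (m + 1) :=
    (hu.pow _).integrable_of_hasCompactSupport
      (huc.comp_left (g := fun t : ℝ => t ^ (m + 1)) (by simp))
  have huvint : Integrable fun x => u x ^ m * v x :=
    ((hu.pow _).mul hv).integrable_of_hasCompactSupport hvc.mul_left
  refine integral_pow_rpow_le_of_integral_pow_mul_le hu hv huc hvc hu0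
    (fun x => norm_nonneg _) hm (by positivity) ?_
  have := integral_mono (huint.const_mul (m : ℝ))
    ((huvint.const_mul ((m : ℝ) + 1)).add ((hGint.const_mul ((m : ℝ) + 1)).add hDint)) hpt
  rw [integral_add' (huvint.const_mul _) ((hGint.const_mul _).add hDint),
    integral_add' (hGint.const_mul _) hDint, integral_const_mul, integral_const_mul,
    integral_const_mul, hDeq] at this
  push_cast at this
  rw [div_mul_eq_mul_div, le_div_iff₀ hm0]
  linarith

/-- Critical (logarithmic) Hardy inequality on a bounded domain `Ω ⊂ ℝⁿ`. -/
theorem stmt9 (n : ℕ) (hn : 2 ≤ n) (Ω : Set (EuclideanSpace ℝ (Fin n)))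
    (hΩo : IsOpen Ω) (hΩb : Bornology.IsBounded Ω)
    (h0 : (0 : EuclideanSpace ℝ (Fin n)) ∈ Ω)
    (R : ℝ) (hR : R = sSup ((fun x => ‖x‖) '' Ω))
    (f : EuclideanSpace ℝ (Fin n) → ℂ) (hf : ContDiff ℝ (⊤ : ℕ∞) f)
    (hfc : HasCompactSupport f)
    (hfs : tsupport f ⊆ Ω \ {0}) (hfs' : tsupport f ⊆ {x | ‖x‖ < R}) :
    (∫ x in Ω, ‖f x‖ ^ n / (‖x‖ * Real.log (R / ‖x‖)) ^ n) ^ (1 / (n : ℝ))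
      ≤ ((n : ℝ) / ((n : ℝ) - 1)) *
        (∫ x in Ω, ‖fderiv ℝ f x ((‖x‖)⁻¹ • x)‖ ^ n) ^ (1 / (n : ℝ)) := by
  obtain ⟨m, rfl⟩ : ∃ m, n = m + 1 := ⟨n - 1, by omega⟩
  have hsub : tsupport f ⊆ Ω := fun x hx => (hfs hx).1
  rw [setIntegral_eq_integral_of_forall_compl_eq_zero,
    setIntegral_eq_integral_of_forall_compl_eq_zero]
  · have := critical_hardy_whole_space (m := m) (by omega) (hf.of_le (by simp)) hfc
      fun x hx => ⟨(hfs hx).2, hfs' hx⟩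
    simpa [div_pow] using this
  · intro x hx
    have : fderiv ℝ f x = 0 := by
      by_contra h
      exact hx (hsub (support_fderiv_subset ℝ h))
    simp [this]
  · intro x hx
    have : f x = 0 := image_eq_zero_of_notMem_tsupport fun h => hx (hsub h)
    simp [this]
end
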